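/- arXiv:2202.00428 — 7 statements merged into one kernel-verified Lean document; each statement's English description precedes it below -/
import Mathlib

section
/- A diagram D is reachable if and only if D admits a starting-file matching. -/
/-- A square: file `s.1` with `1 ≤ s.1 ≤ n`, rank `s.2` with `2 ≤ s.2 ≤ n - 1`. -/
def IsSq (n : ℕ) (s : ℤ × ℤ) : Prop :=
  1 ≤ s.1 ∧ s.1 ≤ (n : ℤ) ∧ 2 ≤ s.2 ∧ s.2 ≤ (n : ℤ) - 1

/-- The potential starting files of a pawn on square `s`. -/
noncomputable def mu (n : ℕ) (s : ℤ × ℤ) : Finset ℤ :=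
  Finset.Icc (max 1 (s.1 - (s.2 - 2))) (min (n : ℤ) (s.1 + (s.2 - 2)))

/-- `u` is a file interval `[u.1, u.2]` with `1 ≤ u.1 ≤ u.2 ≤ n`. -/
def IsInterval (n : ℕ) (u : ℤ × ℤ) : Prop :=
  1 ≤ u.1 ∧ u.1 ≤ u.2 ∧ u.2 ≤ (n : ℤ)

/-- All squares of the board. -/
noncomputable def board (n : ℕ) : Finset (ℤ × ℤ) :=
  Finset.Icc 1 (n : ℤ) ×ˢ Finset.Icc 2 ((n : ℤ) - 1)

/-- The squares whose potential starting files all lie inside the interval `u`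
(the empty set when `u.1 > u.2`). -/
noncomputable def vset (n : ℕ) (u : ℤ × ℤ) : Finset (ℤ × ℤ) :=
  (board n).filter (fun s => mu n s ⊆ Finset.Icc u.1 u.2)

/-- The number of files of the interval `u`, i.e. `u.2 - u.1 + 1`. -/
def isize (u : ℤ × ℤ) : ℕ := (u.2 - u.1 + 1).toNat

/-- A diagram is a finite set of squares. -/
def IsDiagram (n : ℕ) (D : Finset (ℤ × ℤ)) : Prop := ∀ s ∈ D, IsSq n s

/-- A family `U` of file intervals is satisfiable if some diagram with at most `n`
pawns has more than `|u|` pawns inside `vset n u` for every `u ∈ U`. -/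
def Satisfiable (n : ℕ) (U : Finset (ℤ × ℤ)) : Prop :=
  ∃ D : Finset (ℤ × ℤ), IsDiagram n D ∧ D.card ≤ n ∧
    ∀ u ∈ U, isize u < (D ∩ vset n u).card

/-- A single pawn move. -/
def Move (n : ℕ) (D D' : Finset (ℤ × ℤ)) : Prop :=
  ∃ f r f' : ℤ, (f, r) ∈ D ∧ r ≤ (n : ℤ) - 2 ∧ |f' - f| ≤ 1 ∧ 1 ≤ f' ∧ f' ≤ (n : ℤ) ∧
    (f', r + 1) ∉ D ∧ D' = insert (f', r + 1) (D.erase (f, r))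

/-- A diagram is reachable if it is obtained by finitely many single pawn moves
from a diagram consisting only of squares of rank 2. -/
def Reachable (n : ℕ) (D : Finset (ℤ × ℤ)) : Prop :=
  ∃ D₀ : Finset (ℤ × ℤ), IsDiagram n D₀ ∧ (∀ s ∈ D₀, s.2 = 2) ∧
    Relation.ReflTransGen (Move n) D₀ D

/-- `D` admits a starting-file matching: an injective assignment of pawns to
starting files, each pawn to one of its potential starting files. -/
def HasMatching (n : ℕ) (D : Finset (ℤ × ℤ)) : Prop :=
  ∃ φ : ℤ × ℤ → ℤ, Set.InjOn φ ↑D ∧ ∀ s ∈ D, φ s ∈ mu n s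

theorem matching_of_swap {n : ℕ} {D : Finset (ℤ × ℤ)} {φ : ℤ × ℤ → ℤ} {s t : ℤ × ℤ}
    (hinj : Set.InjOn φ ↑D) (hmu : ∀ x ∈ D, φ x ∈ mu n x) (hs : s ∈ D) (ht : t ∉ D)
    (h : φ s ∈ mu n t) : HasMatching n (insert t (D.erase s)) := by
  refine ⟨Function.update φ t (φ s), ?_, ?_⟩
  · intro x hx y hy hxy
    simp only [Finset.coe_insert, Finset.coe_erase, Set.mem_insert_iff, Set.mem_sdiff,
      Finset.mem_coe, Set.mem_singleton_iff] at hx hy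
    by_cases hxt : x = t <;> by_cases hyt : y = t
    · rw [hxt, hyt]
    · obtain ⟨hyD, hys⟩ := hy.resolve_left hyt
      rw [hxt, Function.update_self, Function.update_of_ne hyt] at hxy
      exact absurd (hinj hs hyD hxy).symm hys
    · obtain ⟨hxD, hxs⟩ := hx.resolve_left hxt
      rw [hyt, Function.update_self, Function.update_of_ne hxt] at hxy
      exact absurd (hinj hxD hs hxy) hxs
    · rw [Function.update_of_ne hyt, Function.update_of_ne hxt] at hxy
      exact hinj (hx.resolve_left hxt).1 (hy.resolve_left hyt).1 hxy
  · intro x hx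
    by_cases hxt : x = t
    · rw [hxt, Function.update_self]; exact h
    · rw [Function.update_of_ne hxt]
      exact hmu x (Finset.mem_of_mem_erase ((Finset.mem_insert.1 hx).resolve_left hxt))

theorem diagram_swap {n : ℕ} {D : Finset (ℤ × ℤ)} {s t : ℤ × ℤ}
    (hD : IsDiagram n D) (h : IsSq n t) : IsDiagram n (insert t (D.erase s)) := by
  intro x hx
  rcases Finset.mem_insert.1 hx with rfl | hx
  · exact h
  · exact hD x (Finset.mem_of_mem_erase hx)

theorem matching_of_reachable {n : ℕ} {D₀ D : Finset (ℤ × ℤ)} (h0 : IsDiagram n D₀)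
    (h2 : ∀ s ∈ D₀, s.2 = 2) (h : Relation.ReflTransGen (Move n) D₀ D) :
    IsDiagram n D ∧ HasMatching n D := by
  induction h with
  | refl =>
    refine ⟨h0, Prod.fst, ?_, ?_⟩
    · intro x hx y hy hxy
      exact Prod.ext hxy ((h2 x hx).trans (h2 y hy).symm)
    · intro s hs
      have := h0 s hs
      have := h2 s hs
      simp only [mu, IsSq, Finset.mem_Icc] at *
      omega
  | tail _ hm ih =>
    obtain ⟨hD, φ, hinj, hmu⟩ := ih
    obtain ⟨f, r, f', hs, hr, habs, h1, hn', ht, rfl⟩ := hm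
    have hsq := hD _ hs
    have hm := hmu _ hs
    rw [abs_le] at habs
    refine ⟨diagram_swap hD ?_, matching_of_swap hinj hmu hs ht ?_⟩
    · simp only [IsSq] at *; omega
    · simp only [IsSq, mu, Finset.mem_Icc] at *; omega

theorem reachable_of_matching {n : ℕ} (k : ℕ) : ∀ D : Finset (ℤ × ℤ), IsDiagram n D →
    HasMatching n D → (∑ s ∈ D, s.2.toNat) = k → Reachable n D := by
  induction k using Nat.strong_induction_on with
  | _ k ih =>
  intro D hD hM hk
  by_cases hall : ∀ s ∈ D, s.2 = 2
  · exact ⟨D, hD, hall, Relation.ReflTransGen.refl⟩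
  have hne : (D.filter (fun s => s.2 ≠ 2)).Nonempty := by
    push Not at hall
    obtain ⟨s, hs, h⟩ := hall
    exact ⟨s, Finset.mem_filter.2 ⟨hs, h⟩⟩
  obtain ⟨⟨f, r⟩, hsF, hmin⟩ := Finset.exists_min_image _ (fun s : ℤ × ℤ => s.2) hne
  obtain ⟨hs, hr2⟩ := Finset.mem_filter.1 hsF
  obtain ⟨φ, hinj, hmu⟩ := hM
  have hsq := hD _ hs
  have hms := hmu _ hs
  obtain ⟨f', hf'⟩ : ∃ f' : ℤ, f' = max (f - 1) (min (f + 1) (φ (f, r))) := ⟨_, rfl⟩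
  simp only [IsSq, mu, Finset.mem_Icc] at hsq hms hr2
  have ht : (f', r - 1) ∉ D := by
    intro ht
    by_cases h3 : r - 1 = 2
    · have h1 := hmu _ ht
      simp only [mu, Finset.mem_Icc] at h1
      have := hinj ht hs (by omega)
      simp at this
    · have := hmin _ (Finset.mem_filter.2 ⟨ht, h3⟩)
      simp only at this
      omega
  have hM' : HasMatching n (insert (f', r - 1) (D.erase (f, r))) :=
    matching_of_swap hinj hmu hs ht (by simp only [mu, Finset.mem_Icc]; omega)
  have hD' : IsDiagram n (insert (f', r - 1) (D.erase (f, r))) :=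
    diagram_swap hD (by simp only [IsSq]; omega)
  have hte : (f', r - 1) ∉ D.erase (f, r) := fun h => ht (Finset.mem_of_mem_erase h)
  have hsum : (∑ s ∈ insert (f', r - 1) (D.erase (f, r)), s.2.toNat) < k := by
    rw [Finset.sum_insert hte, ← hk, ← Finset.add_sum_erase D _ hs]
    simp only
    omega
  obtain ⟨D₀, h0, h2, hreach⟩ := ih _ hsum _ hD' hM' rfl
  refine ⟨D₀, h0, h2, hreach.tail ⟨f', r - 1, f, Finset.mem_insert_self _ _, by omega, ?_,
    by omega, by omega, ?_, ?_⟩⟩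
  · rw [abs_le]; omega
  · simp only [sub_add_cancel, Finset.mem_insert, Finset.mem_erase, Prod.mk.injEq]
    rintro (⟨_, h⟩ | ⟨h, _⟩)
    · omega
    · simp at h
  · rw [Finset.erase_insert hte, sub_add_cancel, Finset.insert_erase hs]

/-- A diagram `D` is reachable iff it admits a starting-file matching. -/
theorem reachable_iff_hasMatching (n : ℕ) (hn : 3 ≤ n)
    (D : Finset (ℤ × ℤ)) (hD : IsDiagram n D) :
    Reachable n D ↔ HasMatching n D := by
  constructor
  · rintro ⟨D₀, h0, h2, h⟩
    exact (matching_of_reachable h0 h2 h).2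
  · intro h
    exact reachable_of_matching _ D hD h rfl
end

section
/- A diagram D admits a starting-file matching if and only if for every file interval u, |D ∩ v_u| ≤ |u|. (This is Hall's condition restricted to intervals of files, which suffices because each set μ_s is an interval.) -/
theorem mu_nonempty_aux (n : ℕ) (hn : 3 ≤ n) (s : ℤ × ℤ) (hs : IsSq n s) :
    max 1 (s.1 - (s.2 - 2)) ≤ min (n : ℤ) (s.1 + (s.2 - 2)) := by
  obtain ⟨h1, h2, h3, h4⟩ := hs
  omega

theorem hall_aux (n : ℕ) (hn : 3 ≤ n) (D : Finset (ℤ × ℤ)) (hD : IsDiagram n D)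
    (h : ∀ u : ℤ × ℤ, IsInterval n u → (D ∩ vset n u).card ≤ isize u) :
    ∀ (m : ℕ) (T : Finset ℤ), T.card ≤ m → T ⊆ Finset.Icc 1 (n : ℤ) →
      (D.filter (fun s => mu n s ⊆ T)).card ≤ T.card := by
  classical
  intro m
  induction m with
  | zero =>
    intro T hT _
    have hT0 : T = ∅ := Finset.card_eq_zero.mp (by omega)
    subst hT0
    rw [Finset.filter_false_of_mem]
    · simp
    · intro s hs hsub
      have h1 := mu_nonempty_aux n hn s (hD s hs)
      exact absurd (hsub (Finset.left_mem_Icc.mpr h1)) (by simp)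
  | succ m ih =>
    intro T hT hTn
    rcases T.eq_empty_or_nonempty with hT0 | hne
    · exact ih T (by simp [hT0]) hTn
    set a := T.min' hne with ha
    have haT : a ∈ T := T.min'_mem hne
    have hmin : ∀ x ∈ T, a ≤ x := fun x hx => T.min'_le x hx
    have ha1 := Finset.mem_Icc.mp (hTn haT)
    have hex : ∃ k : ℕ, a + (k : ℤ) ∉ T := by
      refine ⟨n + 1, fun hk => ?_⟩
      have := Finset.mem_Icc.mp (hTn hk)
      push_cast at this
      omega
    obtain ⟨k, hk, hlt⟩ : ∃ k : ℕ, a + (k : ℤ) ∉ T ∧ ∀ j < k, a + (j : ℤ) ∈ T :=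
      ⟨Nat.find hex, Nat.find_spec hex, fun j hj => not_not.mp (Nat.find_min hex hj)⟩
    have hk0 : 0 < k := by
      rcases Nat.eq_zero_or_pos k with h0 | h0
      · subst h0
        simp [haT] at hk
      · exact h0
    set b : ℤ := a + k - 1 with hb
    have hsub : Finset.Icc a b ⊆ T := by
      intro x hx
      rw [Finset.mem_Icc] at hx
      have := hlt (x - a).toNat (by omega)
      rwa [show a + (((x - a).toNat : ℕ) : ℤ) = x by omega] at this
    have hbT : b ∈ T := hsub (Finset.mem_Icc.mpr ⟨by omega, le_refl _⟩)
    have hbn := Finset.mem_Icc.mp (hTn hbT)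
    have hcard : (T \ Finset.Icc a b).card + (Finset.Icc a b).card = T.card :=
      Finset.card_sdiff_add_card_eq_card hsub
    have hcI : (Finset.Icc a b).card = isize (a, b) := by
      simp only [Int.card_Icc, isize]
      congr 1
      omega
    have hpos : 0 < (Finset.Icc a b).card :=
      Finset.card_pos.mpr ⟨a, Finset.mem_Icc.mpr ⟨le_refl _, by omega⟩⟩
    have h1 := h (a, b) ⟨ha1.1, by show a ≤ b; omega, hbn.2⟩
    have h2 := ih (T \ Finset.Icc a b) (by omega) (Finset.sdiff_subset.trans hTn)
    have h3 : D.filter (fun s => mu n s ⊆ T) ⊆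
        (D ∩ vset n (a, b)) ∪ D.filter (fun s => mu n s ⊆ T \ Finset.Icc a b) := by
      intro s hs
      rw [Finset.mem_filter] at hs
      obtain ⟨hsD, hsT⟩ := hs
      have hsq := hD s hsD
      have hlr := mu_nonempty_aux n hn s hsq
      obtain ⟨q1, q2, q3, q4⟩ := hsq
      rw [Finset.mem_union]
      unfold mu at hsT
      set l := max 1 (s.1 - (s.2 - 2)) with hl
      set r := min (n : ℤ) (s.1 + (s.2 - 2)) with hr
      have hal := hmin l (hsT (Finset.left_mem_Icc.mpr hlr))
      by_cases hlb : l ≤ b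
      · left
        have hrb : r ≤ b := by
          by_contra hcon
          apply hk
          apply hsT
          rw [Finset.mem_Icc]
          constructor <;> omega
        rw [Finset.mem_inter]
        refine ⟨hsD, ?_⟩
        unfold vset board
        rw [Finset.mem_filter, Finset.mem_product, Finset.mem_Icc, Finset.mem_Icc]
        refine ⟨⟨⟨q1, q2⟩, q3, q4⟩, ?_⟩
        exact Finset.Icc_subset_Icc hal hrb
      · right
        rw [Finset.mem_filter]
        refine ⟨hsD, fun x hx => ?_⟩
        have hx' : x ∈ Finset.Icc l r := hx
        rw [Finset.mem_sdiff]
        refine ⟨hsT hx', fun hx2 => ?_⟩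
        rw [Finset.mem_Icc] at hx' hx2
        omega
    have h4 := (Finset.card_le_card h3).trans (Finset.card_union_le _ _)
    omega

/-- `D` admits a starting-file matching iff Hall's condition holds on
every file interval: `|D ∩ v_u| ≤ |u|`. -/
theorem hasMatching_iff_hall (n : ℕ) (hn : 3 ≤ n)
    (D : Finset (ℤ × ℤ)) (hD : IsDiagram n D) :
    HasMatching n D ↔
      ∀ u : ℤ × ℤ, IsInterval n u → (D ∩ vset n u).card ≤ isize u := by
  classical
  constructor
  · rintro ⟨φ, hinj, hφ⟩ u hu
    have hc : isize u = (Finset.Icc u.1 u.2).card := by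
      simp only [Int.card_Icc, isize]
      congr 1
      omega
    rw [hc]
    apply Finset.card_le_card_of_injOn φ
    · intro s hs
      have hs' := Finset.mem_inter.mp (Finset.mem_coe.mp hs)
      exact Finset.mem_coe.mpr ((Finset.mem_filter.mp hs'.2).2 (hφ s hs'.1))
    · exact hinj.mono (fun s hs => Finset.mem_coe.mpr
        (Finset.mem_inter.mp (Finset.mem_coe.mp hs)).1)
  · intro h
    have key := (Finset.all_card_le_biUnion_card_iff_exists_injective
      (fun s : {s // s ∈ D} => mu n s.1)).mp (by
        intro S
        have hN : S.biUnion (fun s : {s // s ∈ D} => mu n s.1) ⊆ Finset.Icc 1 (n : ℤ) := by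
          intro x hx
          obtain ⟨s, _, hx⟩ := Finset.mem_biUnion.mp hx
          unfold mu at hx
          rw [Finset.mem_Icc] at hx ⊢
          omega
        refine le_trans ?_ (hall_aux n hn D hD h _ _ le_rfl hN)
        apply Finset.card_le_card_of_injOn (fun s => s.1)
        · intro s hs
          apply Finset.mem_coe.mpr
          rw [Finset.mem_filter]
          exact ⟨s.2, fun x hx => Finset.mem_biUnion.mpr ⟨s, hs, hx⟩⟩
        · exact Subtype.val_injective.injOn)
    obtain ⟨f, hf, hfm⟩ := key
    refine ⟨fun s => if hs : s ∈ D then f ⟨s, hs⟩ else 0, ?_, ?_⟩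
    · intro x hx y hy hxy
      have hx' : x ∈ D := hx
      have hy' : y ∈ D := hy
      simp only [hx', hy', dif_pos] at hxy
      exact congrArg Subtype.val (hf hxy)
    · intro s hs
      simp only [hs, dif_pos]
      exact hfm ⟨s, hs⟩
end

section
/- Let U′ be an unsatisfiable finite family of file intervals (an 'unsat core'). Suppose U′′ is obtained from U′ either by applying the file reflection u = [u_l, u_r] ↦ [n + 1 − u_r, n + 1 − u_l] to every member, or by applying a translation u ↦ [u_l + k, u_r + k] to every member, where all intervals of U′ and all their translates are contained in [2, n − 1]. If U′′ ⊆ U, then U is unsatisfiable. -/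
/-- File reflection of an interval. -/
def refInt (n : ℕ) (u : ℤ × ℤ) : ℤ × ℤ := ((n : ℤ) + 1 - u.2, (n : ℤ) + 1 - u.1)

theorem mem_vset_iff (n : ℕ) (u s : ℤ × ℤ) : s ∈ vset n u ↔
    IsSq n s ∧ (u.1 ≤ 1 ∨ u.1 ≤ s.1 - (s.2 - 2)) ∧
      ((n : ℤ) ≤ u.2 ∨ s.1 + (s.2 - 2) ≤ u.2) := by
  unfold vset board mu IsSq
  simp only [Finset.mem_filter, Finset.mem_product, Finset.mem_Icc]
  constructor
  · rintro ⟨⟨⟨h1, h2⟩, h3, h4⟩, h⟩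
    have hne : max 1 (s.1 - (s.2 - 2)) ≤ min (n : ℤ) (s.1 + (s.2 - 2)) := by omega
    rw [Finset.Icc_subset_Icc_iff hne] at h
    omega
  · rintro ⟨⟨h1, h2, h3, h4⟩, h5, h6⟩
    refine ⟨⟨⟨h1, h2⟩, h3, h4⟩, ?_⟩
    apply Finset.Icc_subset_Icc <;> omega

theorem sat_transfer (n : ℕ) (U' U : Finset (ℤ × ℤ)) (φ g : ℤ × ℤ → ℤ × ℤ)
    (hg : Function.Injective g) (hφ : ∀ u ∈ U', φ u ∈ U)
    (hsize : ∀ u, isize (φ u) = isize u)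
    (hv : ∀ u ∈ U', ∀ s ∈ vset n (φ u), g s ∈ vset n u)
    (h : Satisfiable n U) : Satisfiable n U' := by
  classical
  obtain ⟨D, -, hc, hD⟩ := h
  refine ⟨(D.image g).filter (IsSq n), fun s hs => (Finset.mem_filter.1 hs).2,
    (Finset.card_filter_le _ _).trans (Finset.card_image_le.trans hc), fun u hu => ?_⟩
  have h1 := hD _ (hφ u hu)
  rw [hsize, ← Finset.card_image_of_injective _ hg] at h1
  refine h1.trans_le (Finset.card_le_card ?_)
  intro t ht
  obtain ⟨s, hs, rfl⟩ := Finset.mem_image.1 ht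
  rw [Finset.mem_inter] at hs
  have h2 := hv u hu s hs.2
  exact Finset.mem_inter.2 ⟨Finset.mem_filter.2
    ⟨Finset.mem_image_of_mem _ hs.1, ((mem_vset_iff _ _ _).1 h2).1⟩, h2⟩

/-- if `U` contains a file-reflection, or a translation (within
`[2, n-1]`), of an unsatisfiable core `U'`, then `U` is unsatisfiable. -/
theorem unsat_of_contains_core_image (n : ℕ) (hn : 3 ≤ n)
    (U' U'' U : Finset (ℤ × ℤ))
    (hU' : ∀ u ∈ U', IsInterval n u) (hU : ∀ u ∈ U, IsInterval n u)
    (hcore : ¬ Satisfiable n U')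
    (himg : U'' = U'.image (refInt n) ∨
      ∃ k : ℤ, U'' = U'.image (fun u => (u.1 + k, u.2 + k)) ∧
        ∀ u ∈ U', 2 ≤ u.1 ∧ u.2 ≤ (n : ℤ) - 1 ∧
          2 ≤ u.1 + k ∧ u.2 + k ≤ (n : ℤ) - 1)
    (hsub : U'' ⊆ U) :
    ¬ Satisfiable n U := by
  intro hsat
  apply hcore
  rcases himg with rfl | ⟨k, rfl, hk⟩
  · refine sat_transfer n U' U (refInt n) (fun s => ((n : ℤ) + 1 - s.1, s.2)) ?_
      (fun u hu => hsub (Finset.mem_image_of_mem _ hu)) ?_ ?_ hsat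
    · intro a b hab
      simp only [Prod.mk.injEq] at hab
      ext <;> omega
    · intro u
      simp only [isize, refInt]
      congr 1
      ring
    · intro u hu s hs
      rw [mem_vset_iff] at hs ⊢
      simp only [IsSq, refInt] at hs ⊢
      omega
  · refine sat_transfer n U' U (fun u => (u.1 + k, u.2 + k)) (fun s => (s.1 - k, s.2)) ?_
      (fun u hu => hsub (Finset.mem_image_of_mem (fun u : ℤ × ℤ => (u.1 + k, u.2 + k)) hu))
      ?_ ?_ hsat
    · intro a b hab
      simp only [Prod.mk.injEq] at hab
      ext <;> omega
    · intro u
      simp only [isize]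
      congr 1
      ring
    · intro u hu s hs
      have := hk u hu
      rw [mem_vset_iff] at hs ⊢
      simp only [IsSq] at hs ⊢
      omega
end

section
/- Let U be a finite family of file intervals such that every u = [u_l, u_r] ∈ U satisfies u_r ≤ n − 2, and let U′ = {[u_l + 1, u_r + 1] : u ∈ U} be U right-shifted by one file. If U is unsatisfiable, then U′ is unsatisfiable. -/
/-- if every interval of `U` has `u_r ≤ n - 2` and `U` is
unsatisfiable, then `U` right-shifted by one file is unsatisfiable. -/
theorem unsat_right_shift (n : ℕ) (hn : 3 ≤ n)
    (U : Finset (ℤ × ℤ)) (hU : ∀ u ∈ U, IsInterval n u ∧ u.2 ≤ (n : ℤ) - 2)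
    (h : ¬ Satisfiable n U) :
    ¬ Satisfiable n (U.image (fun u => (u.1 + 1, u.2 + 1))) := by
  rintro ⟨D, hD, hc, hs⟩
  apply h
  have inj : Function.Injective (fun s : ℤ × ℤ => (s.1 - 1, s.2)) := by
    rintro ⟨a, b⟩ ⟨c, d⟩ e
    simp only [Prod.mk.injEq] at e ⊢
    omega
  refine ⟨(D.filter (fun s => 2 ≤ s.1)).image (fun s => (s.1 - 1, s.2)), ?_, ?_, ?_⟩
  · intro s hs'
    obtain ⟨t, ht, rfl⟩ := Finset.mem_image.1 hs'
    obtain ⟨ht, h2⟩ := Finset.mem_filter.1 ht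
    obtain ⟨a, b, c, d⟩ := hD t ht
    refine ⟨?_, ?_, c, d⟩ <;> dsimp only <;> omega
  · exact (Finset.card_image_le.trans (Finset.card_filter_le _ _)).trans hc
  · intro u hu
    obtain ⟨⟨h1, h2, h3⟩, h4⟩ := hU u hu
    have key := hs _ (Finset.mem_image_of_mem _ hu)
    have e : isize (u.1 + 1, u.2 + 1) = isize u := by
      unfold isize
      congr 1
      dsimp only
      ring
    rw [e] at key
    refine key.trans_le ?_
    rw [← Finset.card_image_of_injective _ inj]
    apply Finset.card_le_card
    intro s hs'
    obtain ⟨t, ht, rfl⟩ := Finset.mem_image.1 hs'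
    obtain ⟨htD, htv⟩ := Finset.mem_inter.1 ht
    obtain ⟨a, b, c, d⟩ := hD t htD
    obtain ⟨-, hm⟩ := Finset.mem_filter.1 htv
    unfold mu at hm
    rw [Finset.Icc_subset_Icc_iff (by omega)] at hm
    obtain ⟨m1, m2⟩ := hm
    dsimp only at m1 m2
    refine Finset.mem_inter.2 ⟨Finset.mem_image.2
      ⟨t, Finset.mem_filter.2 ⟨htD, by omega⟩, rfl⟩, Finset.mem_filter.2 ⟨?_, ?_⟩⟩
    · simp only [board, Finset.mem_product, Finset.mem_Icc]
      omega
    · unfold mu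
      apply Finset.Icc_subset_Icc <;> dsimp only <;> omega
end

section
/- Let U be a finite family of file intervals and u = [u_l, u_r] a file interval such that every w ∈ U satisfies w_l ≤ u_l, and every member w of U ∪ {u} satisfies |w| < |v_w| and |w| < n. Let u′ be either [u_l, u_r + t] with t ≥ 1 and u_r + t ≤ n (u right-lengthened) or [u_l + k, u_r + k] with k ≥ 1 and u_r + k ≤ n (u right-shifted). If U ∪ {u} is unsatisfiable, then U ∪ {u′} is unsatisfiable. -/
/-- Exchange argument: move pawns from `V' \ V` into `V`. -/
theorem exchange_aux (D V V' : Finset (ℤ × ℤ)) (m : ℕ) (hV : m ≤ V.card)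
    (hD : (D ∩ V).card ≤ m) (hV' : m ≤ (D ∩ V').card) :
    ∃ D' : Finset (ℤ × ℤ), D' ⊆ D ∪ V ∧ D'.card ≤ D.card ∧ m ≤ (D' ∩ V).card ∧
      (∀ W, V ⊆ W → (D ∩ W).card ≤ (D' ∩ W).card) ∧
      (∀ W, W ∩ V' ⊆ V → (D ∩ W).card ≤ (D' ∩ W).card) := by
  obtain ⟨A, hA1, hA2, hA3⟩ :=
    Finset.exists_subsuperset_card_eq (Finset.inter_subset_right : D ∩ V ⊆ V) hD hV
  have h1 : m - (D ∩ V).card ≤ ((D ∩ V') \ V).card := by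
    have e := Finset.card_sdiff_add_card_inter (D ∩ V') V
    have e2 : ((D ∩ V') ∩ V).card ≤ (D ∩ V).card := by
      apply Finset.card_le_card
      intro x hx
      simp only [Finset.mem_inter] at hx ⊢
      tauto
    omega
  obtain ⟨B, hB1, hB2⟩ := Finset.exists_subset_card_eq h1
  have hBm : ∀ x ∈ B, x ∈ D ∧ x ∈ V' ∧ x ∉ V := by
    intro x hx
    have := hB1 hx
    simp only [Finset.mem_sdiff, Finset.mem_inter] at this
    tauto
  have hAm : ∀ x, x ∈ D → x ∈ V → x ∈ A := fun x h h' => hA1 (Finset.mem_inter.2 ⟨h, h'⟩)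
  refine ⟨(D \ B) ∪ A, ?_, ?_, ?_, ?_, ?_⟩
  · intro x hx
    simp only [Finset.mem_union, Finset.mem_sdiff] at hx ⊢
    have := @hA2 x
    tauto
  · have e : (D \ B) ∪ A = ((D \ V) \ B) ∪ A := by
      ext x
      simp only [Finset.mem_union, Finset.mem_sdiff]
      have := hAm x
      tauto
    have e1 : B ⊆ D \ V := by
      intro x hx
      have := hBm x hx
      simp only [Finset.mem_sdiff]
      tauto
    rw [e]
    have e2 := Finset.card_union_le ((D \ V) \ B) A
    have e3 := Finset.card_sdiff_add_card_eq_card e1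
    have e4 := Finset.card_sdiff_add_card_inter D V
    omega
  · rw [← hA3]
    apply Finset.card_le_card
    intro x hx
    have := hA2 hx
    simp only [Finset.mem_union, Finset.mem_inter]
    tauto
  · intro W hW
    have e : (((D ∩ W) \ V) \ B) ∪ A ⊆ ((D \ B) ∪ A) ∩ W := by
      intro x hx
      simp only [Finset.mem_union, Finset.mem_sdiff, Finset.mem_inter] at hx ⊢
      have h2 := @hA2 x
      have h3 := @hW x
      tauto
    have e1 : Disjoint (((D ∩ W) \ V) \ B) A := by
      rw [Finset.disjoint_left]
      intro x hx hxA
      have h2 := hA2 hxA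
      simp only [Finset.mem_sdiff] at hx
      tauto
    have e2 := Finset.card_le_card e
    rw [Finset.card_union_of_disjoint e1] at e2
    have e3 := Finset.le_card_sdiff B ((D ∩ W) \ V)
    have e4 := Finset.card_sdiff_add_card_inter (D ∩ W) V
    have e5 : ((D ∩ W) ∩ V).card ≤ (D ∩ V).card := by
      apply Finset.card_le_card
      intro x hx
      simp only [Finset.mem_inter] at hx ⊢
      tauto
    omega
  · intro W hW
    apply Finset.card_le_card
    intro x hx
    have h2 := hBm x
    have h3 := @hW x
    simp only [Finset.mem_union, Finset.mem_sdiff, Finset.mem_inter] at hx h3 ⊢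
    tauto

theorem vset_isSq (n : ℕ) (w s : ℤ × ℤ) (h : s ∈ vset n w) : IsSq n s := by
  simp only [vset, board, Finset.mem_filter, Finset.mem_product, Finset.mem_Icc] at h
  unfold IsSq
  tauto

/-- if `U ∪ {u}` is unsatisfiable (all left endpoints of `U` at most
`u_l`, no always-unsat member), then `U ∪ {u'}` is unsatisfiable for `u'` obtained
from `u` by right-lengthening or right-shifting within the board. -/
theorem unsat_right_lengthen_or_shift (n : ℕ) (hn : 3 ≤ n)
    (U : Finset (ℤ × ℤ)) (u u' : ℤ × ℤ)
    (hU : ∀ w ∈ U, IsInterval n w) (hu : IsInterval n u)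
    (hleft : ∀ w ∈ U, w.1 ≤ u.1)
    (hgood : ∀ w ∈ insert u U, isize w < (vset n w).card ∧ isize w < n)
    (hu' : (∃ t : ℤ, 1 ≤ t ∧ u.2 + t ≤ (n : ℤ) ∧ u' = (u.1, u.2 + t)) ∨
           (∃ k : ℤ, 1 ≤ k ∧ u.2 + k ≤ (n : ℤ) ∧ u' = (u.1 + k, u.2 + k)))
    (h : ¬ Satisfiable n (insert u U)) :
    ¬ Satisfiable n (insert u' U) := by
  rintro ⟨D, hD, hDn, hDU⟩
  apply h
  have hl : u.1 ≤ u'.1 := by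
    rcases hu' with ⟨t, h1, h2, rfl⟩ | ⟨t, h1, h2, rfl⟩ <;> simp <;> omega
  have hs : isize u ≤ isize u' := by
    rcases hu' with ⟨t, h1, h2, rfl⟩ | ⟨t, h1, h2, rfl⟩ <;> simp only [isize] <;> omega
  by_cases hc : isize u < (D ∩ vset n u).card
  · refine ⟨D, hD, hDn, ?_⟩
    intro w hw
    rcases Finset.mem_insert.1 hw with rfl | hw
    · exact hc
    · exact hDU w (Finset.mem_insert_of_mem hw)
  have hg := (hgood u (Finset.mem_insert_self _ _)).1
  have hd' := hDU u' (Finset.mem_insert_self _ _)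
  obtain ⟨D', h1, h2, h3, h4, h5⟩ := exchange_aux D (vset n u) (vset n u') (isize u + 1)
    (by omega) (by omega) (by omega)
  refine ⟨D', ?_, by omega, ?_⟩
  · intro s hs'
    rcases Finset.mem_union.1 (h1 hs') with h6 | h6
    · exact hD s h6
    · exact vset_isSq n u s h6
  · intro w hw
    rcases Finset.mem_insert.1 hw with rfl | hw
    · omega
    · refine lt_of_lt_of_le (hDU w (Finset.mem_insert_of_mem hw)) ?_
      have hwl := hleft w hw
      by_cases hr : u.2 ≤ w.2
      · apply h4
        intro s hs'
        simp only [vset, Finset.mem_filter] at hs' ⊢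
        exact ⟨hs'.1, hs'.2.trans (Finset.Icc_subset_Icc hwl hr)⟩
      · apply h5
        intro s hs'
        simp only [vset, Finset.mem_filter, Finset.mem_inter] at hs' ⊢
        refine ⟨hs'.1.1, ?_⟩
        intro x hx
        have a := hs'.1.2 hx
        have b := hs'.2.2 hx
        simp only [Finset.mem_Icc] at a b ⊢
        omega
end

section
/- Let I = [I_l, I_r] and u = [u_l, u_r] be file intervals with I_l ≤ u_l, and let W be a nonempty finite family of file intervals each satisfying w_l ≤ u_l. Set D = ⋃_{w∈W} v_w and D_r = max_{w∈W} w_r. Then v_u ∩ (v_I \ D) = v_{[u_l, min(I_r, u_r)]} \ v_{[u_l, D_r]}, where v of an interval whose left endpoint exceeds its right endpoint is the empty set. -/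
theorem mem_vset_iff_aux (n : ℕ) (u s : ℤ × ℤ) : s ∈ vset n u ↔
    s ∈ board n ∧ u.1 ≤ max 1 (s.1 - (s.2 - 2)) ∧ min (n : ℤ) (s.1 + (s.2 - 2)) ≤ u.2 := by
  unfold vset mu
  rw [Finset.mem_filter]
  refine and_congr_right fun h => ?_
  apply Finset.Icc_subset_Icc_iff
  simp only [board, Finset.mem_product, Finset.mem_Icc] at h
  omega

/-- with `D = ⋃_{w∈W} v_w` and `D_r = max_{w∈W} w_r` (all `w_l ≤ u_l`),
`v_u ∩ (v_I \ D) = v_{[u_l, min(I_r, u_r)]} \ v_{[u_l, D_r]}`. -/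
theorem vset_inter_sdiff (n : ℕ) (hn : 3 ≤ n)
    (I u : ℤ × ℤ) (W : Finset (ℤ × ℤ)) (hne : W.Nonempty)
    (hI : IsInterval n I) (hu : IsInterval n u) (hIu : I.1 ≤ u.1)
    (hW : ∀ w ∈ W, IsInterval n w ∧ w.1 ≤ u.1) :
    vset n u ∩ (vset n I \ W.biUnion (vset n)) =
      vset n (u.1, min I.2 u.2) \ vset n (u.1, W.sup' hne Prod.snd) := by
  ext s
  simp only [Finset.mem_inter, Finset.mem_sdiff, Finset.mem_biUnion, mem_vset_iff_aux,
    Finset.le_sup'_iff, le_min_iff]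
  constructor
  · rintro ⟨⟨hb, h1, h2⟩, ⟨-, -, h3⟩, h4⟩
    refine ⟨⟨hb, h1, h3, h2⟩, ?_⟩
    rintro ⟨-, -, w, hw, h5⟩
    exact h4 ⟨w, hw, hb, (hW w hw).2.trans h1, h5⟩
  · rintro ⟨⟨hb, h1, h3, h2⟩, h4⟩
    refine ⟨⟨hb, h1, h2⟩, ⟨hb, hIu.trans h1, h3⟩, ?_⟩
    rintro ⟨w, hw, -, -, h5⟩
    exact h4 ⟨hb, h1, w, hw, h5⟩
end

section
/- Let u = [u_l, u_r] be a file interval with 2 ≤ u_l and u_r ≤ n − 1, and write k = |u| = u_r − u_l + 1. Then v_u = {(f, r) : 2 ≤ r ≤ n − 1 and u_l + (r − 2) ≤ f ≤ u_r − (r − 2)} (a triangle of squares), and |v_u| = ⌊(k + 1)² / 4⌋. -/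
theorem sum_rows_aux (m : ℕ) : ∀ k : ℕ, k ≤ 2 * m →
    ∑ j ∈ Finset.range m, (k - 2 * j) = (k + 1) ^ 2 / 4 := by
  induction m with
  | zero => intro k hk; obtain rfl : k = 0 := by omega
            simp
  | succ m ih =>
    intro k hk
    rw [Finset.sum_range_succ']
    match k, hk with
    | 0, _ => simp
    | 1, _ =>
      have : ∑ j ∈ Finset.range m, (1 - 2 * (j + 1)) = 0 :=
        Finset.sum_eq_zero (fun j _ => by omega)
      rw [this]
      norm_num
    | k + 2, hk =>
      have h : ∑ j ∈ Finset.range m, (k + 2 - 2 * (j + 1)) = ∑ j ∈ Finset.range m, (k - 2 * j) :=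
        Finset.sum_congr rfl (fun j _ => by omega)
      rw [h, ih k (by omega)]
      have e : (k + 2 + 1) ^ 2 = (k + 1) ^ 2 + 4 * (k + 2) := by ring
      rw [e]
      omega

theorem mem_vset_aux (n : ℕ) (u : ℤ × ℤ) (hu : IsInterval n u) (h2 : 2 ≤ u.1)
    (h1 : u.2 ≤ (n : ℤ) - 1) (s : ℤ × ℤ) :
    s ∈ vset n u ↔ 2 ≤ s.2 ∧ s.2 ≤ (n : ℤ) - 1 ∧
        u.1 + (s.2 - 2) ≤ s.1 ∧ s.1 ≤ u.2 - (s.2 - 2) := by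
  obtain ⟨f, r⟩ := s
  obtain ⟨a, b⟩ := u
  simp only [IsInterval] at hu h1 h2
  rw [vset, Finset.mem_filter, board, Finset.mem_product, Finset.mem_Icc, Finset.mem_Icc, mu]
  simp only
  constructor
  · rintro ⟨⟨⟨hf1, hf2⟩, hr1, hr2⟩, hs⟩
    rw [Finset.Icc_subset_Icc_iff (by omega)] at hs
    omega
  · rintro ⟨hr1, hr2, hf1, hf2⟩
    refine ⟨by omega, Finset.Icc_subset_Icc (by omega) (by omega)⟩

/-- for an interval `u ⊆ [2, n-1]` with `k = |u|` files, `v_u` is the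
triangle `{(f, r) : 2 ≤ r ≤ n - 1, u_l + (r-2) ≤ f ≤ u_r - (r-2)}` and
`|v_u| = ⌊(k+1)²/4⌋`. -/
theorem vset_triangle_card (n : ℕ) (hn : 3 ≤ n)
    (u : ℤ × ℤ) (hu : IsInterval n u) (h2 : 2 ≤ u.1) (h1 : u.2 ≤ (n : ℤ) - 1) :
    (↑(vset n u) : Set (ℤ × ℤ)) =
      {s : ℤ × ℤ | 2 ≤ s.2 ∧ s.2 ≤ (n : ℤ) - 1 ∧
        u.1 + (s.2 - 2) ≤ s.1 ∧ s.1 ≤ u.2 - (s.2 - 2)} ∧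
    (vset n u).card = (isize u + 1) ^ 2 / 4 := by
  have hmem := mem_vset_aux n u hu h2 h1
  refine ⟨Set.ext fun s => by simpa using hmem s, ?_⟩
  have hk : (isize u : ℤ) = u.2 - u.1 + 1 := by
    have := hu.2.1
    unfold isize
    omega
  rw [← sum_rows_aux (n - 2) (isize u) (by omega)]
  rw [Finset.card_eq_sum_card_fiberwise (f := fun s : ℤ × ℤ => (s.2 - 2).toNat)
    (t := Finset.range (n - 2))]
  · refine Finset.sum_congr rfl fun j hj => ?_
    rw [Finset.mem_range] at hj
    have hfib : (vset n u).filter (fun s => (s.2 - 2).toNat = j) =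
        (Finset.Icc (u.1 + j) (u.2 - j)) ×ˢ {(j : ℤ) + 2} := by
      ext s
      rw [Finset.mem_filter, hmem, Finset.mem_product, Finset.mem_Icc, Finset.mem_singleton]
      omega
    rw [hfib, Finset.card_product, Int.card_Icc, Finset.card_singleton]
    omega
  · intro s hs
    have := (hmem s).1 hs
    simp only [Finset.coe_range, Set.mem_Iio]
    omega
end
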